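/- Suppose S2 ≠ ∅. If for some i ∈ {1,...,5} (indices modulo 5) there exist b_i ∈ B_i and b_{i+1} ∈ B_{i+1} with b_i not adjacent to b_{i+1}, then either neither b_i nor b_{i+1} has a neighbor in S2, or there exists a vertex z ∈ S2 such that N(b_i) ∩ S2 = N(b_{i+1}) ∩ S2 = {z}. -/

import Mathlib

open SimpleGraph

/-- The disjoint union `P2 ∪ P3`: an edge 0-1 together with a path 2-3-4. -/
def p2p3 : SimpleGraph (Fin 5) :=
  SimpleGraph.fromEdgeSet {s(0,1), s(2,3), s(3,4)}

variable {V : Type*}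

/-- `S0` is the vertex set of the induced 5-cycle. -/
def S0 (v : Fin 5 → V) : Set V := Set.range v

/-- `Aset H v i` is the set of vertices outside `S0` whose neighborhood in `S0`
is exactly `{v i}`. -/
def Aset (H : SimpleGraph V) (v : Fin 5 → V) (i : Fin 5) : Set V :=
  {x | x ∉ S0 v ∧ ∀ j : Fin 5, H.Adj x (v j) ↔ j = i}

/-- `Bset H v i` is the set of vertices outside `S0` whose neighborhood in `S0`
is exactly `{v (i-1), v (i+1)}`. -/
def Bset (H : SimpleGraph V) (v : Fin 5 → V) (i : Fin 5) : Set V :=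
  {x | x ∉ S0 v ∧ ∀ j : Fin 5, H.Adj x (v j) ↔ (j = i - 1 ∨ j = i + 1)}

/-- `S2set H v` is the set of vertices at distance exactly 2 from `S0`: vertices outside `S0`
with no neighbor in `S0` but with a neighbor having a neighbor in `S0`. -/
def S2set (H : SimpleGraph V) (v : Fin 5 → V) : Set V :=
  {x | x ∉ S0 v ∧ (∀ j : Fin 5, ¬ H.Adj x (v j)) ∧
    ∃ y, H.Adj x y ∧ ∃ j : Fin 5, H.Adj y (v j)}

/-- `S` is complete to `T`: every vertex of `S` is adjacent to every vertex of `T`. -/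
def Complete (H : SimpleGraph V) (S T : Set V) : Prop := ∀ x ∈ S, ∀ y ∈ T, H.Adj x y

/-- `S` is anticomplete to `T`: there are no edges between `S` and `T`. -/
def Anticomplete (H : SimpleGraph V) (S T : Set V) : Prop := ∀ x ∈ S, ∀ y ∈ T, ¬ H.Adj x y

/-- `hA` is the number of indices `i` with `A_i` nonempty. -/
noncomputable def hA (H : SimpleGraph V) (v : Fin 5 → V) : ℕ :=
  {i : Fin 5 | (Aset H v i).Nonempty}.ncard

/-- `hB` is the number of indices `i` with `B_i` nonempty. -/
noncomputable def hB (H : SimpleGraph V) (v : Fin 5 → V) : ℕ :=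
  {i : Fin 5 | (Bset H v i).Nonempty}.ncard

/-- An edge `a b` and an induced path `c d e` with no edges between them form an induced
copy of `P2 ∪ P3`. -/
theorem nonempty_p2p3_embedding (H : SimpleGraph V) {a b c d e : V}
    (hab : H.Adj a b) (hcd : H.Adj c d) (hde : H.Adj d e) (hne : c ≠ e) (hce : ¬ H.Adj c e)
    (hac : ¬ H.Adj a c) (had : ¬ H.Adj a d) (hae : ¬ H.Adj a e)
    (hbc : ¬ H.Adj b c) (hbd : ¬ H.Adj b d) (hbe : ¬ H.Adj b e) :
    Nonempty (p2p3 ↪g H) := by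
  refine ⟨⟨⟨![a, b, c, d, e], ?_⟩, ?_⟩⟩
  · intro x y hxy
    fin_cases x <;> fin_cases y <;> simp at hxy ⊢ <;> subst hxy <;>
      simp_all [H.adj_comm]
  · intro x y
    change H.Adj (![a, b, c, d, e] x) (![a, b, c, d, e] y) ↔ _
    fin_cases x <;> fin_cases y <;> simp_all [p2p3, H.adj_comm]

/-- If `b'` has two nonadjacent neighbors `p`, `q` in `S0` that miss `b`, and `b` is not adjacent
to `b'`, then every neighbor of `b` in `S2` is a neighbor of `b'`. -/
theorem adj_of_adj_of_mem_S2set (H : SimpleGraph V) (v : Fin 5 → V)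
    (hP2P3 : ¬ Nonempty (p2p3 ↪g H)) {b b' p q z : V}
    (hp : p ∈ S0 v) (hq : q ∈ S0 v) (hz : z ∈ S2set H v)
    (hne : p ≠ q) (hpq : ¬ H.Adj p q) (hp' : H.Adj b' p) (hq' : H.Adj b' q)
    (hbp : ¬ H.Adj b p) (hbq : ¬ H.Adj b q) (hbb : ¬ H.Adj b b') (hbz : H.Adj b z) :
    H.Adj b' z := by
  obtain ⟨j, rfl⟩ := hp
  obtain ⟨k, rfl⟩ := hq
  by_contra h
  exact hP2P3 (nonempty_p2p3_embedding H hbz hp'.symm hq' hne hpq hbp hbb hbq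
    (hz.2.1 j) (fun h' => h h'.symm) (hz.2.1 k))

theorem stmt14 {V : Type*} [Fintype V] (H : SimpleGraph V) (v : Fin 5 → V)
    (hinj : Function.Injective v)
    (hC5 : ∀ i j : Fin 5, H.Adj (v i) (v j) ↔ (j = i + 1 ∨ i = j + 1))
    (htriangle : H.CliqueFree 3)
    (hP2P3 : ¬ Nonempty (p2p3 ↪g H))
    (hS2 : (S2set H v).Nonempty)
    : ∀ i : Fin 5, ∀ b ∈ Bset H v i, ∀ b' ∈ Bset H v (i + 1), ¬ H.Adj b b' →
      ((H.neighborSet b ∩ S2set H v = ∅ ∧ H.neighborSet b' ∩ S2set H v = ∅) ∨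
        ∃ z ∈ S2set H v,
          H.neighborSet b ∩ S2set H v = {z} ∧ H.neighborSet b' ∩ S2set H v = {z}) := by
  intro i b hb b' hb' hbb
  have fwd : ∀ z ∈ S2set H v, H.Adj b z → H.Adj b' z := fun z hz hbz => by
    refine adj_of_adj_of_mem_S2set H v hP2P3 (p := v i) (q := v (i + 2))
      ⟨_, rfl⟩ ⟨_, rfl⟩ hz ?_ ?_ ?_ ?_ ?_ ?_
      hbb hbz
    all_goals
      simp only [ne_eq, hinj.eq_iff, hC5, hb.2, hb'.2]
      clear * -
      decide +revert
  have bwd : ∀ z ∈ S2set H v, H.Adj b' z → H.Adj b z := fun z hz hbz => by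
    refine adj_of_adj_of_mem_S2set H v hP2P3 (p := v (i - 1)) (q := v (i + 1))
      ⟨_, rfl⟩ ⟨_, rfl⟩ hz ?_ ?_ ?_ ?_ ?_ ?_
      (fun h => hbb h.symm) hbz
    all_goals
      simp only [ne_eq, hinj.eq_iff, hC5, hb.2, hb'.2]
      clear * -
      decide +revert
  have uniq : ∀ z ∈ S2set H v, ∀ w ∈ S2set H v, H.Adj b z → H.Adj b w → w = z := by
    intro z hz w hw hbz hbw
    by_contra hne
    have hwz : ¬ H.Adj w z := fun h => by
      classical exact htriangle {b, w, z} (is3Clique_triple_iff.2 ⟨hbw, hbz, h⟩)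
    have h2 : ¬ H.Adj b (v (i + 2)) := by
      rw [hb.2]; clear * -; decide +revert
    have h3 : ¬ H.Adj b (v (i + 3)) := by
      rw [hb.2]; clear * -; decide +revert
    have h23 : H.Adj (v (i + 2)) (v (i + 3)) := by
      rw [hC5]; clear * -; decide +revert
    exact hP2P3 (nonempty_p2p3_embedding H h23 hbw.symm hbz hne hwz
      (fun h => hw.2.1 _ h.symm) (fun h => h2 h.symm) (fun h => hz.2.1 _ h.symm)
      (fun h => hw.2.1 _ h.symm) (fun h => h3 h.symm) (fun h => hz.2.1 _ h.symm))
  by_cases hex : ∃ z ∈ S2set H v, H.Adj b z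
  · obtain ⟨z, hz, hbz⟩ := hex
    refine .inr ⟨z, hz, ?_, ?_⟩ <;> ext w <;>
      simp only [Set.mem_inter_iff, mem_neighborSet, Set.mem_singleton_iff]
    · exact ⟨fun h => uniq z hz w h.2 hbz h.1, fun h => h ▸ ⟨hbz, hz⟩⟩
    · exact ⟨fun h => uniq z hz w h.2 hbz (bwd w h.2 h.1), fun h => h ▸ ⟨fwd z hz hbz, hz⟩⟩
  · refine .inl ⟨?_, ?_⟩ <;> refine Set.eq_empty_of_forall_notMem fun w hw => hex ⟨w, hw.2, ?_⟩
    · exact hw.1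
    · exact bwd w hw.2 hw.1
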